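/- There exists an absolute constant K > 0 with the following property. Let b ≥ 2 be an integer and A ⊆ [0,1) a set satisfying T_b(A ∩ ℚ) ⊆ A which is not dense in [0,1], and let ε = sup{dist(x, A) : x ∈ [0,1)}. Then for any rational number a/d ∈ A with gcd(ab, d) = 1 and εd ≥ 3: if P(d) > b then P(d) ≥ K·√((1/log b) · log(2εd) · log log(2εd)), and if P(d) < b then P(d) ≥ K·√((1/log b) · log(2εd)). -/

import Mathlib

/-- The map `T_b : x ↦ bx (mod 1)`, i.e. the fractional part of `bx`. -/
noncomputable def Tb (b : ℕ) (x : ℝ) : ℝ := Int.fract ((b : ℝ) * x)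

/-- `Pd d` is the largest prime divisor of `d`. -/
def Pd (d : ℕ) : ℕ := d.primeFactors.sup id

/-- Lifting the exponent, as a divisibility: a prime power dividing `c ^ n - 1` divides
`(c - 1) * n`, provided `c ≡ 1` modulo the prime (modulo `4` if the prime is `2`). -/
theorem prime_pow_dvd_sub_one_mul {p k n : ℕ} {c : ℤ} (hp : p.Prime) (hc : (p : ℤ) ∣ c - 1)
    (h4 : p = 2 → 4 ∣ c - 1) (h : (p : ℤ) ^ k ∣ c ^ n - 1) : (p : ℤ) ^ k ∣ (c - 1) * n := by
  have hpZ : Prime (p : ℤ) := Nat.prime_iff_prime_int.mp hp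
  have hpc : ¬ (p : ℤ) ∣ c := fun hd ↦ hpZ.not_isUnit <| isUnit_of_dvd_one <| by
    simpa using dvd_sub hd hc
  rw [pow_dvd_iff_le_emultiplicity] at h ⊢
  rw [emultiplicity_mul hpZ]
  rcases eq_or_ne p 2 with rfl | h2
  · simpa using h.trans_eq (by simpa using Int.two_pow_sub_pow' (y := 1) n (h4 rfl) hpc)
  · have := Int.emultiplicity_pow_sub_pow hp (hp.odd_of_ne_two h2) (y := 1) hc hpc n
    rw [Int.natCast_emultiplicity]
    simpa [← this] using h

/-- An exponent annihilating the units modulo `p`, and modulo `4` when `p = 2`. -/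
def liftExponent (p : ℕ) : ℕ := if p = 2 then 2 else p - 1

theorem liftExponent_pos {p : ℕ} (hp : p.Prime) : 0 < liftExponent p := by
  have := hp.two_le
  unfold liftExponent
  split_ifs <;> omega

theorem liftExponent_le (p : ℕ) : liftExponent p ≤ p := by
  unfold liftExponent
  split_ifs <;> omega

theorem dvd_pow_liftExponent_sub_one {p b : ℕ} (hp : p.Prime) (hb : b.Coprime p) :
    (p : ℤ) ∣ (b : ℤ) ^ liftExponent p - 1 ∧ (p = 2 → 4 ∣ (b : ℤ) ^ liftExponent p - 1) := by
  unfold liftExponent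
  split_ifs with h
  · subst h
    have hodd : Odd (b : ℤ) := by
      exact_mod_cast Nat.coprime_two_right.mp hb
    have h4 : (4 : ℤ) ∣ (b : ℤ) ^ 2 - 1 := by
      obtain ⟨m, hm⟩ := hodd
      exact ⟨m ^ 2 + m, by rw [hm]; ring⟩
    exact ⟨(by norm_num : ((2 : ℕ) : ℤ) ∣ 4).trans h4, fun _ ↦ h4⟩
  · refine ⟨?_, fun h' ↦ absurd h' h⟩
    exact (Int.ModEq.pow_card_sub_one_eq_one hp (by
      exact_mod_cast hb)).symm.dvd

/-- A common multiple of the exponents `liftExponent p` over the primes dividing `d`. -/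
def totalExponent (d : ℕ) : ℕ := ∏ p ∈ d.primeFactors, liftExponent p

theorem totalExponent_pos (d : ℕ) : 0 < totalExponent d :=
  Finset.prod_pos fun _ hp ↦ liftExponent_pos (Nat.prime_of_mem_primeFactors hp)

theorem dvd_pow_totalExponent_sub_one {p b d : ℕ} (hp : p ∈ d.primeFactors) (hb : b.Coprime d) :
    (p : ℤ) ∣ (b : ℤ) ^ totalExponent d - 1 ∧
      (p = 2 → 4 ∣ (b : ℤ) ^ totalExponent d - 1) := by
  have hdvd : (b : ℤ) ^ liftExponent p - 1 ∣ (b : ℤ) ^ totalExponent d - 1 := by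
    obtain ⟨m, hm⟩ : liftExponent p ∣ totalExponent d := Finset.dvd_prod_of_mem _ hp
    rw [hm]
    exact pow_one_sub_dvd_pow_mul_sub_one _ _ _
  have := dvd_pow_liftExponent_sub_one (Nat.prime_of_mem_primeFactors hp)
    (hb.coprime_dvd_right (Nat.dvd_of_mem_primeFactors hp))
  exact ⟨this.1.trans hdvd, fun h ↦ (this.2 h).trans hdvd⟩

/-- The subgroup generated by `b` modulo `d` contains every residue that is `1` modulo
`orbitModulus b d`. -/
def orbitModulus (b d : ℕ) : ℕ := d.gcd (b ^ totalExponent d - 1)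

theorem orbitModulus_dvd (b d : ℕ) : orbitModulus b d ∣ d := Nat.gcd_dvd_left _ _

theorem dvd_pow_sub_one_mul {b d n : ℕ} (hb1 : 1 ≤ b) (hb : b.Coprime d)
    (h : (d : ℤ) ∣ ((b : ℤ) ^ totalExponent d) ^ n - 1) :
    d ∣ (b ^ totalExponent d - 1) * n := by
  rw [Nat.dvd_iff_prime_pow_dvd_dvd]
  intro p k hp hk
  rcases Nat.eq_zero_or_pos k with rfl | hk0
  · simp
  rcases Nat.eq_zero_or_pos d with rfl | hd
  · have : b = 1 := by simpa using hb
    simp [this]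
  have hmem : p ∈ d.primeFactors :=
    Nat.mem_primeFactors.mpr ⟨hp, (dvd_pow_self p hk0.ne').trans hk, hd.ne'⟩
  obtain ⟨h1, h2⟩ := dvd_pow_totalExponent_sub_one hmem hb
  have hk' : (p : ℤ) ^ k ∣ d := by exact_mod_cast hk
  have := prime_pow_dvd_sub_one_mul hp h1 h2 (hk'.trans h)
  zify [Nat.one_le_pow (totalExponent d) b hb1]
  exact this

theorem div_orbitModulus_dvd {b d n : ℕ} (hb1 : 1 ≤ b) (hb : b.Coprime d) (hd : 0 < d)
    (h : (d : ℤ) ∣ ((b : ℤ) ^ totalExponent d) ^ n - 1) : d / orbitModulus b d ∣ n := by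
  have hg : 0 < orbitModulus b d := Nat.gcd_pos_of_pos_left _ hd
  have h1 := dvd_pow_sub_one_mul hb1 hb h
  have hco : (d / orbitModulus b d).Coprime ((b ^ totalExponent d - 1) / orbitModulus b d) :=
    Nat.coprime_div_gcd_div_gcd hg
  refine hco.dvd_of_dvd_mul_left ?_
  have hdvd : orbitModulus b d ∣ b ^ totalExponent d - 1 := Nat.gcd_dvd_right _ _
  rwa [← Nat.mul_dvd_mul_iff_left hg, ← mul_assoc, Nat.mul_div_cancel' (orbitModulus_dvd b d),
    Nat.mul_div_cancel' hdvd]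

theorem orbitModulus_le {b d : ℕ} (hb2 : 2 ≤ b) (hb : b.Coprime d) (hd : 0 < d) :
    orbitModulus b d ≤ b ^ (2 * ∑ p ∈ d.primeFactors, p) := by
  set M := totalExponent d * ∏ p ∈ d.primeFactors, (b ^ liftExponent p - 1) with hM
  have hMpos : 0 < M := Nat.mul_pos (totalExponent_pos d) <| Finset.prod_pos fun p hp ↦ by
    have := Nat.one_lt_pow (liftExponent_pos (Nat.prime_of_mem_primeFactors hp)).ne'
      (show 1 < b by omega)
    omega
  have hdvd : orbitModulus b d ∣ M := by
    rw [Nat.dvd_iff_prime_pow_dvd_dvd]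
    intro p k hp hk
    rcases Nat.eq_zero_or_pos k with rfl | hk0
    · simp
    have hmem : p ∈ d.primeFactors := Nat.mem_primeFactors.mpr
      ⟨hp, (dvd_pow_self p hk0.ne').trans (hk.trans (orbitModulus_dvd b d)), hd.ne'⟩
    obtain ⟨m, hm⟩ : liftExponent p ∣ totalExponent d := Finset.dvd_prod_of_mem _ hmem
    have hk2 : p ^ k ∣ b ^ totalExponent d - 1 := hk.trans (Nat.gcd_dvd_right _ _)
    obtain ⟨h1, h2⟩ := dvd_pow_liftExponent_sub_one hp
      (hb.coprime_dvd_right (Nat.dvd_of_mem_primeFactors hmem))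
    rw [hm, pow_mul] at hk2
    have hk3 : (p : ℤ) ^ k ∣ ((b : ℤ) ^ liftExponent p) ^ m - 1 := by
      have := Int.natCast_dvd_natCast.mpr hk2
      rw [Nat.cast_sub (Nat.one_le_pow _ _ (by positivity))] at this
      exact_mod_cast this
    have hk4 := prime_pow_dvd_sub_one_mul hp h1 h2 hk3
    have hk5 : p ^ k ∣ (b ^ liftExponent p - 1) * m := by
      zify [Nat.one_le_pow (liftExponent p) b (by omega)]
      exact hk4
    rw [hM, mul_comm]
    exact hk5.trans (mul_dvd_mul (Finset.dvd_prod_of_mem (fun p ↦ b ^ liftExponent p - 1) hmem)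
      (hm ▸ Dvd.intro_left _ rfl))
  refine (Nat.le_of_dvd hMpos hdvd).trans ?_
  rw [hM, totalExponent, ← Finset.prod_mul_distrib, Finset.mul_sum, ← Finset.prod_pow_eq_pow_sum]
  refine Finset.prod_le_prod' fun p _ ↦ ?_
  calc liftExponent p * (b ^ liftExponent p - 1)
      ≤ b ^ liftExponent p * b ^ liftExponent p :=
        Nat.mul_le_mul (Nat.lt_pow_self (by omega)).le (Nat.sub_le _ _)
    _ = b ^ (2 * liftExponent p) := by ring
    _ ≤ b ^ (2 * p) := Nat.pow_le_pow_right (by omega)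
        (Nat.mul_le_mul_left 2 (liftExponent_le p))

theorem exists_pow_mul_mod_eq {a b d : ℕ} (hb1 : 1 ≤ b) (hab : (a * b).Coprime d) (hd : 0 < d)
    {k : ℕ} (hk : k < d / orbitModulus b d) :
    ∃ n, b ^ n * a % d = a % orbitModulus b d + orbitModulus b d * k := by
  set D := orbitModulus b d with hD
  set c := b ^ totalExponent d with hc
  have hDpos : 0 < D := Nat.gcd_pos_of_pos_left _ hd
  have hDd : D ∣ d := orbitModulus_dvd b d
  have ha : a.Coprime d := hab.coprime_mul_right
  have hb : b.Coprime d := hab.coprime_mul_left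
  have hc1 : c ≡ 1 [MOD D] :=
    ((Nat.modEq_iff_dvd' (Nat.one_le_pow _ _ hb1)).mpr (Nat.gcd_dvd_right _ _)).symm
  have hmod (n : ℕ) : c ^ n * a % d % D = a % D := by
    rw [Nat.mod_mod_of_dvd _ hDd]
    simpa [Nat.ModEq] using (hc1.pow n).mul_right a
  have hlt {m n : ℕ} (hmn : m < n) (hn : n < d / D) : c ^ m * a % d ≠ c ^ n * a % d := by
    intro h
    have h1 : c ^ m ≡ c ^ n [MOD d] := Nat.ModEq.cancel_right_of_coprime ha.symm h
    have h2 : (1 : ℕ) ≡ c ^ (n - m) [MOD d] := by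
      refine Nat.ModEq.cancel_left_of_coprime (c := c ^ m)
        ((hb.pow_left _).pow_left _).symm ?_
      rwa [mul_one, ← pow_add, Nat.add_sub_cancel' hmn.le]
    have h3 : d / D ∣ n - m := div_orbitModulus_dvd hb1 hb hd (by
      have := (Nat.modEq_iff_dvd).mp h2
      simpa [hc] using this)
    have := Nat.le_of_dvd (by omega) h3
    omega
  have hsurj : Set.SurjOn (fun n ↦ c ^ n * a % d / D) (Finset.range (d / D))
      (Finset.range (d / D)) := by
    refine Finset.surjOn_of_injOn_of_card_le _ ?_ ?_ le_rfl
    · intro n _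
      simpa using Nat.div_lt_div_of_lt_of_dvd hDd (Nat.mod_lt _ hd)
    · intro m hm n hn h
      have he : c ^ m * a % d = c ^ n * a % d := by
        rw [← Nat.mod_add_div (c ^ m * a % d) D, ← Nat.mod_add_div (c ^ n * a % d) D,
          hmod, hmod]
        exact congrArg (fun t ↦ a % D + D * t) h
      rcases lt_trichotomy m n with h' | h' | h'
      · exact absurd he (hlt h' (by simpa using hn))
      · exact h'
      · exact absurd he.symm (hlt h' (by simpa using hm))
  obtain ⟨n, -, hn⟩ := hsurj (by simpa using hk : k ∈ (Finset.range (d / D) : Set ℕ))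
  refine ⟨totalExponent d * n, ?_⟩
  rw [pow_mul, ← hc, ← Nat.mod_add_div (c ^ n * a % d) D, hmod]
  exact congrArg (fun t ↦ a % D + D * t) hn

theorem Tb_natCast_div (b i d : ℕ) : Tb b ((i : ℝ) / d) = ((b * i % d : ℕ) : ℝ) / d := by
  rw [Tb, ← Int.fract_div_natCast_eq_div_natCast_mod]
  push_cast
  rw [mul_div_assoc]

theorem pow_mul_mod_div_mem {A : Set ℝ} {a b d : ℕ} (hA : A ⊆ Set.Ico 0 1)
    (hT : ∀ x ∈ A, (∃ q : ℚ, (q : ℝ) = x) → Tb b x ∈ A) (ha : (a : ℝ) / d ∈ A) (hd : 0 < d)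
    (n : ℕ) : ((b ^ n * a % d : ℕ) : ℝ) / d ∈ A := by
  induction n with
  | zero =>
    have had : a < d := by
      have := (hA ha).2
      rw [div_lt_one (by positivity)] at this
      exact_mod_cast this
    simpa [Nat.mod_eq_of_lt had] using ha
  | succ n ih =>
    have := hT _ ih ⟨((b ^ n * a % d : ℕ) : ℚ) / d, by push_cast; rfl⟩
    rw [Tb_natCast_div, Nat.mul_mod_mod] at this
    rwa [pow_succ', mul_assoc]

theorem infDist_le_orbitModulus_div {A : Set ℝ} {a b d : ℕ} (hb1 : 1 ≤ b)
    (hA : A ⊆ Set.Ico 0 1) (hT : ∀ x ∈ A, (∃ q : ℚ, (q : ℝ) = x) → Tb b x ∈ A)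
    (hab : (a * b).Coprime d) (ha : (a : ℝ) / d ∈ A) (hd : 0 < d) {x : ℝ}
    (hx : x ∈ Set.Ico (0 : ℝ) 1) : Metric.infDist x A ≤ (orbitModulus b d : ℝ) / d := by
  set D := orbitModulus b d with hD
  have hDpos : 0 < D := Nat.gcd_pos_of_pos_left _ hd
  have hDR : (0 : ℝ) < D := by exact_mod_cast hDpos
  have hdR : (0 : ℝ) < d := by exact_mod_cast hd
  have hy : 0 ≤ x * d / D := by have := hx.1; positivity
  have hk1 := Nat.floor_le hy
  have hk2 := Nat.lt_floor_add_one (x * d / D)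
  have hk : ⌊x * d / D⌋₊ < d / D := by
    rw [Nat.floor_lt hy, Nat.cast_div (orbitModulus_dvd b d) hDR.ne']
    gcongr
    nlinarith [hx.2]
  obtain ⟨n, hn⟩ := exists_pow_mul_mod_eq hb1 hab hd hk
  have hmem := pow_mul_mod_div_mem hA hT ha hd n
  rw [hn, ← hD] at hmem
  refine (Metric.infDist_le_dist_of_mem hmem).trans ?_
  have hr : ((a % D : ℕ) : ℝ) ≤ D := by exact_mod_cast (Nat.mod_lt a hDpos).le
  have hr0 : (0 : ℝ) ≤ ((a % D : ℕ) : ℝ) := by positivity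
  rw [le_div_iff₀ hDR] at hk1
  rw [div_lt_iff₀ hDR] at hk2
  rw [Real.dist_eq, ← mul_div_cancel_right₀ x hdR.ne', ← sub_div, abs_div, abs_of_pos hdR,
    mul_div_cancel_right₀ x hdR.ne']
  gcongr
  rw [abs_le]
  push_cast
  constructor <;> nlinarith

theorem gap_mul_le_orbitModulus {A : Set ℝ} {a b d : ℕ} (hb1 : 1 ≤ b)
    (hA : A ⊆ Set.Ico 0 1) (hT : ∀ x ∈ A, (∃ q : ℚ, (q : ℝ) = x) → Tb b x ∈ A)
    (hab : (a * b).Coprime d) (ha : (a : ℝ) / d ∈ A) (hd : 0 < d) :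
    sSup ((fun x => Metric.infDist x A) '' Set.Ico 0 1) * d ≤ orbitModulus b d := by
  rw [← le_div_iff₀ (by exact_mod_cast hd)]
  refine csSup_le (Set.Nonempty.image _ ⟨0, by simp⟩) ?_
  rintro _ ⟨x, hx, rfl⟩
  exact infDist_le_orbitModulus_div hb1 hA hT hab ha hd hx

theorem le_Pd {p d : ℕ} (hp : p ∈ d.primeFactors) : p ≤ Pd d :=
  Finset.le_sup (f := id) hp

theorem card_primeFactors_le_primeCounting_Pd (d : ℕ) :
    d.primeFactors.card ≤ Nat.primeCounting (Pd d) := by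
  rw [Nat.primeCounting, Nat.primeCounting', Nat.count_eq_card_filter_range]
  refine Finset.card_le_card fun p hp ↦ ?_
  simpa [Nat.prime_of_mem_primeFactors hp, Nat.lt_succ_iff] using le_Pd hp

theorem primeCounting_mul_log_le {n : ℕ} (hn : 2 ≤ n) :
    (Nat.primeCounting n : ℝ) * Real.log n ≤ 6 * n := by
  have hnR : (1 : ℝ) < n := by exact_mod_cast (show 1 < n by omega)
  have hlog : 0 < Real.log n := Real.log_pos hnR
  have hpi := Chebyshev.pi_le_log4_mul_div hnR
  rw [Nat.floor_natCast, Real.log_sqrt (by positivity)] at hpi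
  have h4 : Real.log 4 ≤ 2 := by
    rw [show (4 : ℝ) = 2 ^ 2 by norm_num, Real.log_pow]
    have := Real.log_two_lt_d9
    push_cast
    linarith
  have hsq : √(n : ℝ) * √(n : ℝ) = n := Real.mul_self_sqrt (by positivity)
  have hls : Real.log n ≤ 2 * √(n : ℝ) := by
    have h1 := Real.log_le_self (Real.sqrt_nonneg (n : ℝ))
    rw [Real.log_sqrt (by positivity)] at h1
    linarith
  calc (Nat.primeCounting n : ℝ) * Real.log n
      ≤ (Real.log 4 * n / (Real.log n / 2) + √(n : ℝ)) * Real.log n := by gcongr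
    _ = 2 * Real.log 4 * n + √(n : ℝ) * Real.log n := by field_simp
    _ ≤ 2 * 2 * n + √(n : ℝ) * (2 * √(n : ℝ)) := by gcongr
    _ = 6 * n := by linear_combination 2 * hsq

theorem log_two_mul_le {b d : ℕ} {y : ℝ} (hb2 : 2 ≤ b) (hb : b.Coprime d) (hd : 0 < d)
    (hy : 3 ≤ y) (hyD : y ≤ orbitModulus b d) :
    Real.log (2 * y) ≤ 4 * Real.log b * (Pd d * d.primeFactors.card) := by
  have hsum : ∑ p ∈ d.primeFactors, p ≤ Pd d * d.primeFactors.card := by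
    rw [mul_comm, ← smul_eq_mul]
    exact Finset.sum_le_card_nsmul _ _ _ fun p hp ↦ le_Pd hp
  have hyb : y ≤ (b : ℝ) ^ (2 * (Pd d * d.primeFactors.card)) := by
    refine hyD.trans ?_
    exact_mod_cast (orbitModulus_le hb2 hb hd).trans
      (Nat.pow_le_pow_right (by omega) (Nat.mul_le_mul_left 2 hsum))
  have h1 := Real.log_le_log (by linarith) hyb
  rw [Real.log_pow] at h1
  push_cast at h1
  have h2 : Real.log 2 ≤ Real.log y := Real.log_le_log (by norm_num) (by linarith)
  rw [Real.log_mul (by norm_num) (by linarith)]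
  linarith

theorem stmt2 : ∃ K : ℝ, K > 0 ∧
    ∀ (b : ℕ), 2 ≤ b → ∀ (A : Set ℝ), A ⊆ Set.Ico 0 1 →
    (∀ x ∈ A, (∃ q : ℚ, (q : ℝ) = x) → Tb b x ∈ A) →
    ¬ Set.Icc (0 : ℝ) 1 ⊆ closure A →
    ∀ ε : ℝ, ε = sSup ((fun x => Metric.infDist x A) '' Set.Ico 0 1) →
    ∀ a d : ℕ, Nat.Coprime (a * b) d → (a : ℝ) / d ∈ A → ε * d ≥ 3 →
    ((Pd d > b →
        (Pd d : ℝ) ≥ K * Real.sqrt ((1 / Real.log b) * Real.log (2 * ε * d) *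
          Real.log (Real.log (2 * ε * d)))) ∧
      (Pd d < b →
        (Pd d : ℝ) ≥ K * Real.sqrt ((1 / Real.log b) * Real.log (2 * ε * d)))) := by
  refine ⟨1 / 11, by norm_num, ?_⟩
  rintro b hb2 A hA hT - ε rfl a d hab ha hε
  set ε := sSup ((fun x => Metric.infDist x A) '' Set.Ico 0 1)
  have hd : 0 < d := Nat.pos_of_ne_zero fun h ↦ by
    rw [h, Nat.cast_zero, mul_zero] at hε
    linarith
  have hb : b.Coprime d := hab.coprime_mul_left
  have hL := log_two_mul_le hb2 hb hd hε
    (gap_mul_le_orbitModulus (by omega) hA hT hab ha hd)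
  rw [← mul_assoc] at hL
  have hL1 : 1 < Real.log (2 * ε * d) := by
    rw [Real.lt_log_iff_exp_lt (by linarith)]
    linarith [Real.exp_one_lt_d9]
  set L := Real.log (2 * ε * d)
  set P : ℝ := (Pd d : ℝ) with hP
  set N : ℝ := (d.primeFactors.card : ℝ)
  have hP0 : 0 ≤ P := Nat.cast_nonneg _
  have hNP : N ≤ P := by
    refine Nat.cast_le.mpr ((Finset.card_le_card fun p hp ↦ ?_).trans (Nat.card_Icc 1 _).le)
    exact Finset.mem_Icc.mpr ⟨(Nat.prime_of_mem_primeFactors hp).pos, le_Pd hp⟩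
  have hN0 : 0 ≤ N := Nat.cast_nonneg _
  have hbR : (2 : ℝ) ≤ b := by exact_mod_cast hb2
  have hlb : 0 < Real.log b := Real.log_pos (by linarith)
  have hLb : 1 / Real.log b * L ≤ 4 * (P * N) := by
    rw [one_div_mul_eq_div, div_le_iff₀ hlb]
    linarith
  constructor
  · intro hPb
    have hP3 : (3 : ℝ) ≤ P := by
      have : 3 ≤ Pd d := by omega
      rw [hP]
      exact_mod_cast this
    have hbP : (b : ℝ) ≤ P := Nat.cast_le.mpr hPb.le
    have hlogb : Real.log b ≤ P := (Real.log_le_self (by positivity)).trans hbP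
    have hlogL : Real.log L ≤ 5 * Real.log P := by
      have : L ≤ P ^ 5 := calc
        L ≤ 4 * Real.log b * (P * N) := hL
        _ ≤ 4 * P * (P * P) := by gcongr
        _ ≤ P ^ 2 * P * (P * P) := by
          gcongr
          nlinarith
        _ = P ^ 5 := by ring
      have h := Real.log_le_log (by linarith) this
      rw [Real.log_pow] at h
      exact_mod_cast h
    have hNlog : N * Real.log P ≤ 6 * P := by
      refine le_trans ?_ (primeCounting_mul_log_le (n := Pd d) (by omega))
      refine mul_le_mul_of_nonneg_right ?_ (Real.log_nonneg (by linarith))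
      exact Nat.cast_le.mpr (card_primeFactors_le_primeCounting_Pd d)
    have hsqrt : √(1 / Real.log b * L * Real.log L) ≤ 11 * P := by
      refine Real.sqrt_le_iff.mpr ⟨by positivity, ?_⟩
      calc 1 / Real.log b * L * Real.log L
          ≤ 4 * (P * N) * (5 * Real.log P) :=
            mul_le_mul hLb hlogL (Real.log_nonneg hL1.le) (by positivity)
        _ = 20 * P * (N * Real.log P) := by ring
        _ ≤ 20 * P * (6 * P) := by gcongr
        _ ≤ (11 * P) ^ 2 := by nlinarith
    linarith
  · intro _
    have hsqrt : √(1 / Real.log b * L) ≤ 2 * P := by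
      refine Real.sqrt_le_iff.mpr ⟨by positivity, ?_⟩
      nlinarith
    linarith
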